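/- Let n ≥ 2 and let a_1 > a_2 > ⋯ > a_{n−1} > 0 be positive integers, and set λ := Σ_{i=1}^{n−1} a_i α_i. Then the weighted Kostant sum satisfies S(λ) = q^{−Σ_{i=1}^{n−1} a_i} · (q−1)^{2(n−1)} · [a_{n−1}]_{q^n} · ∏_{i=1}^{n−2} [(i+1)a_i − i·a_{i+1}]_q. -/

import Mathlib

noncomputable def q : RatFunc ℚ := RatFunc.X

noncomputable def qint (b : RatFunc ℚ) (k : ℤ) : RatFunc ℚ := (b ^ k - 1) / (b - 1)

noncomputable def wt (r : ℕ) : RatFunc ℚ :=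
  if r = 0 then 1
  else q ^ (-(r : ℤ)) * (q - 1) ^ 2 * (q ^ (2 * r) - 1) / (q ^ 2 - 1)

def rootZ (i j : ℕ) : ℕ → ℤ := fun k => (if k = i then 1 else 0) - (if k = j then 1 else 0)

def pairs (n : ℕ) : Finset (ℕ × ℕ) :=
  (Finset.Icc 1 n ×ˢ Finset.Icc 1 n).filter fun p => p.1 < p.2

def IsKostant (n : ℕ) (lam : ℕ → ℤ) (r : ℕ × ℕ → ℕ) : Prop :=
  (∀ p ∉ pairs n, r p = 0) ∧
    (∑ p ∈ pairs n, (r p : ℤ) • rootZ p.1 p.2) = lam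

noncomputable def S (n : ℕ) (lam : ℕ → ℤ) : RatFunc ℚ :=
  ∑ᶠ r ∈ {r : ℕ × ℕ → ℕ | IsKostant n lam r}, ∏ p ∈ pairs n, wt (r p)

theorem q_ne_zero : q ≠ 0 := RatFunc.X_ne_zero

theorem q_pow_ne_one (k : ℕ) (hk : k ≠ 0) : q ^ k ≠ 1 := by
  intro h
  have h2 : (algebraMap (Polynomial ℚ) (RatFunc ℚ)) (Polynomial.X ^ k) =
      algebraMap (Polynomial ℚ) (RatFunc ℚ) 1 := by
    rw [map_pow, map_one, RatFunc.algebraMap_X]; exact h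
  have h3 := RatFunc.algebraMap_injective ℚ h2
  have h4 := congrArg Polynomial.natDegree h3
  simp at h4
  exact hk h4

noncomputable def Cc (m : ℕ) : RatFunc ℚ := (q ^ m - 1) * (q - 1) / (q ^ (m + 1) - 1)

noncomputable def W (m r : ℕ) : RatFunc ℚ :=
  if r = 0 then 1 else Cc m * ((q ^ m) ^ r - (q⁻¹) ^ r)

theorem W_one (r : ℕ) : W 1 r = wt r := by
  unfold W wt Cc
  split_ifs with h
  · rfl
  · have hq := q_ne_zero
    rw [zpow_neg, zpow_natCast, inv_pow, pow_one]
    have : q ^ r ≠ 0 := pow_ne_zero _ hq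
    have h2 : q ^ 2 - 1 ≠ 0 := sub_ne_zero.2 (q_pow_ne_one 2 (by norm_num))
    have h3 : q ^ (2 * r) = q ^ r * q ^ r := by rw [two_mul, pow_add]
    rw [h3]
    norm_num
    field_simp

open PowerSeries in
theorem W_series (m : ℕ) :
    (PowerSeries.mk (W m)) * ((1 - PowerSeries.C (q ^ m) * X) * (1 - PowerSeries.C (q⁻¹) * X)) =
      (1 - X) * (1 - PowerSeries.C (q ^ m * q⁻¹) * X) := by
  have hG : ∀ u : RatFunc ℚ, PowerSeries.mk (fun s => u ^ s) * (1 - PowerSeries.C u * X) = 1 := by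
    intro u
    ext s
    rw [mul_sub, mul_one, mul_left_comm, ← mul_assoc, map_sub]
    cases s with
    | zero => simp
    | succ s =>
      rw [coeff_succ_mul_X, coeff_C_mul, coeff_mk, coeff_mk, coeff_one]
      simp [pow_succ']
  have hW : PowerSeries.mk (W m) = 1 + PowerSeries.C (Cc m) *
      (PowerSeries.mk (fun s => (q ^ m) ^ s) - PowerSeries.mk (fun s => (q⁻¹) ^ s)) := by
    ext s
    rw [map_add, coeff_C_mul, map_sub, coeff_mk, coeff_mk, coeff_mk, coeff_one]
    unfold W
    split_ifs with h
    · simp [h]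
    · simp
  have hc : Cc m * (q ^ m - q⁻¹) = q ^ m + q⁻¹ - 1 - q ^ m * q⁻¹ := by
    unfold Cc
    have hq := q_ne_zero
    have h2 : q ^ (m + 1) - 1 ≠ 0 := sub_ne_zero.2 (q_pow_ne_one (m + 1) (by omega))
    field_simp
    ring
  have hc' := congrArg (PowerSeries.C (R := RatFunc ℚ)) hc
  simp only [map_mul, map_sub, map_add, map_one] at hc'
  have h1 := hG (q ^ m)
  have h2 := hG (q⁻¹)
  rw [hW]
  simp only [map_mul]
  generalize PowerSeries.mk (fun s => (q ^ m) ^ s) = A at *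
  generalize PowerSeries.mk (fun s => (q⁻¹) ^ s) = B at *
  generalize PowerSeries.C (R := RatFunc ℚ) (q ^ m) = u at *
  generalize PowerSeries.C (R := RatFunc ℚ) (q⁻¹) = v at *
  linear_combination (X : PowerSeries (RatFunc ℚ)) * hc' + PowerSeries.C (Cc m) * (1 - v * X) * h1
    - PowerSeries.C (Cc m) * (1 - u * X) * h2

theorem one_sub_ne (u : RatFunc ℚ) :
    (1 - PowerSeries.C u * PowerSeries.X : PowerSeries (RatFunc ℚ)) ≠ 0 := by
  intro h
  have := congrArg PowerSeries.constantCoeff h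
  simp at this

theorem resc_C (t x : RatFunc ℚ) :
    PowerSeries.rescale t (PowerSeries.C x) = PowerSeries.C x := by
  ext s
  rw [PowerSeries.coeff_rescale, PowerSeries.coeff_C]
  split_ifs with h
  · simp [h]
  · simp

open PowerSeries in
theorem resc (t : RatFunc ℚ) (m : ℕ) :
    (rescale t (PowerSeries.mk (W m))) *
      ((1 - PowerSeries.C (t * q ^ m) * X) * (1 - PowerSeries.C (t * q⁻¹) * X)) =
      (1 - PowerSeries.C t * X) * (1 - PowerSeries.C (t * (q ^ m * q⁻¹)) * X) := by
  have h := congrArg (rescale t) (W_series m)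
  simp only [map_mul, map_sub, map_one, rescale_X, resc_C] at h
  simp only [map_mul]
  linear_combination h

open PowerSeries in
theorem conv_series_u (m : ℕ) :
    PowerSeries.mk (W m) * rescale (q ^ m) (PowerSeries.mk (W 1)) = PowerSeries.mk (W (m + 1)) := by
  have hq := q_ne_zero
  have h1 := W_series m
  have h2 := resc (q ^ m) 1
  have h3 := W_series (m + 1)
  have e1 : q ^ m * q ^ 1 = q ^ (m + 1) := by ring
  have e2 : q ^ m * (q ^ 1 * q⁻¹) = q ^ m := by field_simp
  have e3 : q ^ (m + 1) * q⁻¹ = q ^ m := by field_simp; ring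
  rw [e1, e2] at h2
  rw [e3] at h3
  have n1 := one_sub_ne (q ^ m)
  have n2 := one_sub_ne (q ^ m * q⁻¹)
  have n3 := one_sub_ne (q ^ (m + 1))
  have n4 := one_sub_ne (q⁻¹)
  refine mul_right_cancel₀ (mul_ne_zero (mul_ne_zero n1 n2) (mul_ne_zero n3 n4)) ?_
  generalize (1 - PowerSeries.C (q ^ m) * X : PowerSeries (RatFunc ℚ)) = a1 at *
  generalize (1 - PowerSeries.C (q ^ m * q⁻¹) * X : PowerSeries (RatFunc ℚ)) = a2 at *
  generalize (1 - PowerSeries.C (q ^ (m + 1)) * X : PowerSeries (RatFunc ℚ)) = a3 at *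
  generalize (1 - PowerSeries.C (q⁻¹) * X : PowerSeries (RatFunc ℚ)) = a4 at *
  generalize rescale (q ^ m) (PowerSeries.mk (W 1)) = R at *
  linear_combination (R * a2 * a3) * h1 + (1 - X) * a2 * h2 - a1 * a2 * h3

open PowerSeries in
theorem conv_series_v (m : ℕ) :
    PowerSeries.mk (W m) * rescale (q⁻¹) (PowerSeries.mk (W 1)) =
      rescale (q⁻¹) (PowerSeries.mk (W (m + 1))) := by
  have hq := q_ne_zero
  have h1 := W_series m
  have h2 := resc (q⁻¹) 1
  have h3 := resc (q⁻¹) (m + 1)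
  have e1 : q⁻¹ * q ^ 1 = 1 := by field_simp
  have e2 : q⁻¹ * (q ^ 1 * q⁻¹) = q⁻¹ := by field_simp
  have e3 : q⁻¹ * q ^ (m + 1) = q ^ m := by field_simp; ring
  have e4 : q⁻¹ * (q ^ (m + 1) * q⁻¹) = q ^ m * q⁻¹ := by field_simp; ring
  rw [e1, e2] at h2
  rw [e3, e4] at h3
  simp only [map_one, one_mul] at h2
  have n1 := one_sub_ne (q ^ m)
  have n2 := one_sub_ne (q⁻¹)
  have n3 := one_sub_ne 1
  simp only [map_one, one_mul] at n3
  have n4 := one_sub_ne (q⁻¹ * q⁻¹)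
  refine mul_right_cancel₀ (mul_ne_zero (mul_ne_zero n1 n2) (mul_ne_zero n3 n4)) ?_
  generalize (1 - PowerSeries.C (q ^ m) * X : PowerSeries (RatFunc ℚ)) = a1 at *
  generalize (1 - PowerSeries.C (q ^ m * q⁻¹) * X : PowerSeries (RatFunc ℚ)) = a2 at *
  generalize (1 - X : PowerSeries (RatFunc ℚ)) = a3 at *
  generalize (1 - PowerSeries.C (q⁻¹ * q⁻¹) * X : PowerSeries (RatFunc ℚ)) = a5 at *
  generalize (1 - PowerSeries.C (q⁻¹) * X : PowerSeries (RatFunc ℚ)) = a4 at *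
  generalize rescale (q⁻¹) (PowerSeries.mk (W 1)) = R at *
  linear_combination (R * a3 * a5) * h1 + a3 * a2 * h2 - a4 * a3 * h3

theorem conv_u (m c : ℕ) : ∑ β ∈ Finset.range (c + 1), W m (c - β) * ((q ^ m) ^ β * wt β) =
    W (m + 1) c := by
  have h := congrArg (PowerSeries.coeff c) (conv_series_u m)
  rw [mul_comm, PowerSeries.coeff_mul, Finset.Nat.sum_antidiagonal_eq_sum_range_succ_mk] at h
  simp only [PowerSeries.coeff_rescale, PowerSeries.coeff_mk, W_one] at h
  rw [← h]
  exact Finset.sum_congr rfl fun _ _ => by ring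

theorem conv_v (m c : ℕ) : ∑ β ∈ Finset.range (c + 1), W m (c - β) * ((q⁻¹) ^ β * wt β) =
    (q⁻¹) ^ c * W (m + 1) c := by
  have h := congrArg (PowerSeries.coeff c) (conv_series_v m)
  rw [mul_comm, PowerSeries.coeff_mul, Finset.Nat.sum_antidiagonal_eq_sum_range_succ_mk] at h
  simp only [PowerSeries.coeff_rescale, PowerSeries.coeff_mk, W_one] at h
  rw [← h]
  exact Finset.sum_congr rfl fun _ _ => by ring

def KS (n : ℕ) (b : ℕ → ℕ) (i : ℕ) : Set (ℕ × ℕ → ℕ) :=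
  {r | (∀ x y, ¬ (i ≤ x ∧ x < y ∧ y ≤ n) → r (x, y) = 0) ∧
    ∀ k, i ≤ k → k < n → ∑ x ∈ Finset.Icc i k, ∑ y ∈ Finset.Ioc k n, r (x, y) = b k}

theorem KS_finite (n : ℕ) (b : ℕ → ℕ) (i : ℕ) : (KS n b i).Finite := by
  let F : Finset (ℕ × ℕ) := Finset.range (n + 1) ×ˢ Finset.range (n + 1)
  let M := ∑ k ∈ Finset.range n, b k
  have hb : ∀ r ∈ KS n b i, ∀ x y, r (x, y) ≤ M := by
    intro r hr x y
    by_cases h : i ≤ x ∧ x < y ∧ y ≤ n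
    · have h1 := hr.2 x h.1 (by omega)
      have h2 : ∑ y ∈ Finset.Ioc x n, r (x, y) ≤
          ∑ x' ∈ Finset.Icc i x, ∑ y ∈ Finset.Ioc x n, r (x', y) :=
        Finset.single_le_sum (f := fun x' => ∑ y ∈ Finset.Ioc x n, r (x', y))
          (fun _ _ => Nat.zero_le _) (Finset.mem_Icc.2 ⟨h.1, le_rfl⟩)
      have h3 : r (x, y) ≤ ∑ y ∈ Finset.Ioc x n, r (x, y) :=
        Finset.single_le_sum (f := fun y => r (x, y))
          (fun _ _ => Nat.zero_le _) (Finset.mem_Ioc.2 ⟨h.2.1, h.2.2⟩)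
      have h4 : b x ≤ M := Finset.single_le_sum (f := b)
          (fun _ _ => Nat.zero_le _) (Finset.mem_range.2 (by omega))
      omega
    · rw [hr.1 x y h]; exact Nat.zero_le _
  have hfin : (Set.pi Set.univ (fun _ : {p // p ∈ F} => Set.Iic M)).Finite :=
    Set.Finite.pi (fun _ => Set.finite_Iic M)
  refine Set.Finite.of_injOn (f := fun r => fun p : {p // p ∈ F} => r p.1) ?_ ?_ hfin
  · intro r hr p _
    exact hb r hr p.1.1 p.1.2
  · intro r hr s hs h
    funext ⟨x, y⟩
    by_cases hp : (x, y) ∈ F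
    · exact congrFun h ⟨(x, y), hp⟩
    · have : ¬ (i ≤ x ∧ x < y ∧ y ≤ n) := by
        intro h'
        apply hp
        simp only [F, Finset.mem_product, Finset.mem_range]
        omega
      rw [hr.1 x y this, hs.1 x y this]

noncomputable def KF (n : ℕ) (b : ℕ → ℕ) (i : ℕ) : Finset (ℕ × ℕ → ℕ) := (KS_finite n b i).toFinset

theorem mem_KF {n : ℕ} {b : ℕ → ℕ} {i : ℕ} {r : ℕ × ℕ → ℕ} : r ∈ KF n b i ↔ r ∈ KS n b i := by
  simp [KF]

noncomputable def ww (n i : ℕ) (r : ℕ × ℕ → ℕ) : RatFunc ℚ :=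
  (∏ y ∈ Finset.Ioc i n, W i (r (i, y))) *
    ∏ x ∈ Finset.Ioc i n, ∏ y ∈ Finset.Ioc x n, wt (r (x, y))

noncomputable def TT (n : ℕ) (b : ℕ → ℕ) (i : ℕ) : RatFunc ℚ := ∑ r ∈ KF n b i, ww n i r

def phi (i : ℕ) (r : ℕ × ℕ → ℕ) : ℕ × ℕ → ℕ := fun p =>
  if p.1 = i then 0 else
    if p.1 = i + 1 then (if p.2 ≤ i + 1 then 0 else r (i, p.2) + r (i + 1, p.2)) else r p

def gg (n i d : ℕ) (r : ℕ × ℕ → ℕ) (B : ℕ → ℕ) : ℕ × ℕ → ℕ := fun p =>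
  if p.1 = i then
    (if p.2 = i + 1 then d + ∑ j ∈ Finset.Ioc (i + 1) n, B j
      else if i + 1 < p.2 ∧ p.2 ≤ n then r (i + 1, p.2) - B p.2 else 0)
  else if p.1 = i + 1 then (if i + 1 < p.2 ∧ p.2 ≤ n then B p.2 else 0) else r p

theorem peel_Icc {M : Type*} [AddCommMonoid M] (f : ℕ → M) {i k : ℕ} (h : i ≤ k) :
    ∑ x ∈ Finset.Icc i k, f x = f i + ∑ x ∈ Finset.Icc (i + 1) k, f x := by
  have : Finset.Icc i k = insert i (Finset.Icc (i + 1) k) := by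
    ext; simp only [Finset.mem_Icc, Finset.mem_insert]; omega
  rw [this, Finset.sum_insert (by simp)]

theorem peel_Ioc {M : Type*} [AddCommMonoid M] (f : ℕ → M) {i k : ℕ} (h : i < k) :
    ∑ x ∈ Finset.Ioc i k, f x = f (i + 1) + ∑ x ∈ Finset.Ioc (i + 1) k, f x := by
  have : Finset.Ioc i k = insert (i + 1) (Finset.Ioc (i + 1) k) := by
    ext; simp only [Finset.mem_Ioc, Finset.mem_insert]; omega
  rw [this, Finset.sum_insert (by simp)]

theorem peelp_Ioc {M : Type*} [CommMonoid M] (f : ℕ → M) {i k : ℕ} (h : i < k) :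
    ∏ x ∈ Finset.Ioc i k, f x = f (i + 1) * ∏ x ∈ Finset.Ioc (i + 1) k, f x := by
  have : Finset.Ioc i k = insert (i + 1) (Finset.Ioc (i + 1) k) := by
    ext; simp only [Finset.mem_Ioc, Finset.mem_insert]; omega
  rw [this, Finset.prod_insert (by simp)]

theorem cut_eq (n i k : ℕ) (r r' : ℕ × ℕ → ℕ) (hk : i + 1 ≤ k)
    (h1 : ∀ y, i + 1 < y → y ≤ n → r' (i + 1, y) = r (i, y) + r (i + 1, y))
    (h2 : ∀ x y, i + 1 < x → r' (x, y) = r (x, y)) :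
    ∑ x ∈ Finset.Icc (i + 1) k, ∑ y ∈ Finset.Ioc k n, r' (x, y) =
      ∑ x ∈ Finset.Icc i k, ∑ y ∈ Finset.Ioc k n, r (x, y) := by
  rw [peel_Icc _ hk, peel_Icc (fun x => ∑ y ∈ Finset.Ioc k n, r (x, y)) (show i ≤ k by omega),
    peel_Icc (fun x => ∑ y ∈ Finset.Ioc k n, r (x, y)) hk, ← add_assoc,
    ← Finset.sum_add_distrib]
  congr 1
  · refine Finset.sum_congr rfl fun y hy => ?_
    rw [Finset.mem_Ioc] at hy
    exact h1 y (by omega) hy.2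
  · refine Finset.sum_congr rfl fun x hx => Finset.sum_congr rfl fun y _ => ?_
    rw [Finset.mem_Icc] at hx
    exact h2 x y (by omega)

theorem phi_mem {n : ℕ} {b : ℕ → ℕ} {i : ℕ} {r : ℕ × ℕ → ℕ} (hr : r ∈ KS n b i) :
    phi i r ∈ KS n b (i + 1) := by
  refine ⟨?_, ?_⟩
  · intro x y h
    unfold phi
    dsimp only
    split_ifs with h1 h2 h3
    · rfl
    · rfl
    · rw [hr.1 _ _ (by omega), hr.1 _ _ (by omega)]
    · exact hr.1 _ _ (by omega)
  · intro k hk hkn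
    rw [← hr.2 k (by omega) hkn]
    apply cut_eq n i k r _ hk
    · intro y hy hyn
      simp [phi]; omega
    · intro x y hx
      unfold phi; dsimp only
      rw [if_neg (by omega), if_neg (by omega)]

theorem row_sum {n : ℕ} {b : ℕ → ℕ} {i : ℕ} {r : ℕ × ℕ → ℕ} (hi : i ≤ n) (hbn : b n = 0)
    (hr : r ∈ KS n b i) : ∑ y ∈ Finset.Ioc i n, r (i, y) = b i := by
  rcases hi.eq_or_lt with h | h
  · subst h; simp [hbn]
  · have := hr.2 i le_rfl h
    simpa using this

theorem gg_mem {n : ℕ} {b : ℕ → ℕ} {i : ℕ} {r : ℕ × ℕ → ℕ} {B : ℕ → ℕ} (hi : i < n)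
    (hbn : b n = 0) (hb : b (i + 1) < b i) (hr : r ∈ KS n b (i + 1))
    (hB : ∀ y, i + 1 < y → y ≤ n → B y ≤ r (i + 1, y)) :
    gg n i (b i - b (i + 1)) r B ∈ KS n b i ∧ phi i (gg n i (b i - b (i + 1)) r B) = r := by
  refine ⟨⟨?_, ?_⟩, ?_⟩
  · intro x y h
    unfold gg
    dsimp only
    split_ifs with h1 h2 h3 h4 h5
    any_goals omega
    exact hr.1 _ _ (by omega)
  · intro k hk hkn
    rcases hk.eq_or_lt with h | h
    · subst h
      rw [Finset.Icc_self, Finset.sum_singleton, peel_Ioc _ hi]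
      have h0 := row_sum (show i + 1 ≤ n by omega) hbn hr
      have h1 : ∑ y ∈ Finset.Ioc (i + 1) n, gg n i (b i - b (i + 1)) r B (i, y) +
          ∑ y ∈ Finset.Ioc (i + 1) n, B y = b (i + 1) := by
        rw [← h0, ← Finset.sum_add_distrib]
        refine Finset.sum_congr rfl fun y hy => ?_
        rw [Finset.mem_Ioc] at hy
        have := hB y hy.1 hy.2
        unfold gg
        dsimp only
        rw [if_pos rfl, if_neg (by omega), if_pos hy]
        omega
      have h2 : gg n i (b i - b (i + 1)) r B (i, i + 1) =
        b i - b (i + 1) + ∑ y ∈ Finset.Ioc (i + 1) n, B y := by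
        simp [gg]
      omega
    · rw [← hr.2 k (by omega) hkn]
      symm
      apply cut_eq n i k _ r (by omega)
      · intro y hy hyn
        have := hB y hy hyn
        unfold gg
        dsimp only
        rw [if_pos rfl, if_neg (by omega), if_pos ⟨hy, hyn⟩, if_neg (by omega), if_pos rfl,
          if_pos ⟨hy, hyn⟩]
        omega
      · intro x y hx
        unfold gg; dsimp only
        rw [if_neg (by omega), if_neg (by omega)]
  · funext ⟨x, y⟩
    by_cases h1 : x = i
    · rw [hr.1 x y (by omega)]
      simp [phi, h1]
    by_cases h2 : x = i + 1
    · subst h2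
      by_cases h3 : i + 1 < y ∧ y ≤ n
      · have := hB y h3.1 h3.2
        unfold phi gg
        dsimp only
        rw [if_neg (by omega), if_pos rfl, if_neg (by omega), if_pos rfl, if_neg (by omega),
          if_pos h3, if_neg (by omega), if_pos rfl, if_pos h3]
        omega
      · rw [hr.1 _ y (by omega)]
        unfold phi gg
        dsimp only
        split_ifs <;> omega
    · unfold phi gg
      dsimp only
      rw [if_neg h1, if_neg h2, if_neg h1, if_neg h2]

theorem head_eq {n : ℕ} {b : ℕ → ℕ} {i : ℕ} {r : ℕ × ℕ → ℕ} (hi : i < n)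
    (hbn : b n = 0) (hb : b (i + 1) < b i) (hr : r ∈ KS n b i) :
    r (i, i + 1) = b i - b (i + 1) + ∑ j ∈ Finset.Ioc (i + 1) n, r (i + 1, j) := by
  have h1 := row_sum hi.le hbn hr
  have h2 := row_sum (show i + 1 ≤ n by omega) hbn (phi_mem hr)
  have h3 : ∑ y ∈ Finset.Ioc (i + 1) n, phi i r (i + 1, y) =
      ∑ y ∈ Finset.Ioc (i + 1) n, r (i, y) + ∑ y ∈ Finset.Ioc (i + 1) n, r (i + 1, y) := by
    rw [← Finset.sum_add_distrib]
    refine Finset.sum_congr rfl fun y hy => ?_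
    rw [Finset.mem_Ioc] at hy
    unfold phi
    dsimp only
    rw [if_neg (by omega), if_pos rfl, if_neg (by omega)]
  rw [peel_Ioc _ hi] at h1
  omega

theorem gg_phi {n : ℕ} {b : ℕ → ℕ} {i : ℕ} {r : ℕ × ℕ → ℕ} {B : ℕ → ℕ} (hi : i < n)
    (hbn : b n = 0) (hb : b (i + 1) < b i) (hr : r ∈ KS n b i)
    (hB : ∀ y, i + 1 < y → y ≤ n → B y = r (i + 1, y)) :
    gg n i (b i - b (i + 1)) (phi i r) B = r := by
  have hs : ∑ j ∈ Finset.Ioc (i + 1) n, B j = ∑ j ∈ Finset.Ioc (i + 1) n, r (i + 1, j) :=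
    Finset.sum_congr rfl fun y hy => by
      rw [Finset.mem_Ioc] at hy
      exact hB y hy.1 hy.2
  funext ⟨x, y⟩
  by_cases h1 : x = i
  · subst h1
    by_cases h2 : y = x + 1
    · subst h2
      rw [head_eq hi hbn hb hr, ← hs]
      simp [gg]
    · by_cases h3 : x + 1 < y ∧ y ≤ n
      · have := hB y h3.1 h3.2
        unfold gg phi
        dsimp only
        rw [if_pos rfl, if_neg h2, if_pos h3, if_neg (by omega), if_pos rfl, if_neg (by omega)]
        omega
      · rw [hr.1 _ y (by omega)]
        unfold gg
        dsimp only
        rw [if_pos rfl, if_neg h2, if_neg h3]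
  · by_cases h2 : x = i + 1
    · subst h2
      by_cases h3 : i + 1 < y ∧ y ≤ n
      · unfold gg
        dsimp only
        rw [if_neg h1, if_pos rfl, if_pos h3, hB y h3.1 h3.2]
      · rw [hr.1 _ y (by omega)]
        unfold gg
        dsimp only
        rw [if_neg h1, if_pos rfl, if_neg h3]
    · unfold gg phi
      dsimp only
      rw [if_neg h1, if_neg h2, if_neg h1, if_neg h2]

theorem ww_eq {n : ℕ} {b : ℕ → ℕ} {i : ℕ} {r : ℕ × ℕ → ℕ} (hi : i < n)
    (hbn : b n = 0) (hb : b (i + 1) < b i) (hr : r ∈ KS n b i) :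
    ww n i r = Cc i *
      ((q ^ i) ^ (b i - b (i + 1)) * (∏ y ∈ Finset.Ioc (i + 1) n,
          (W i (phi i r (i + 1, y) - r (i + 1, y)) * ((q ^ i) ^ (r (i + 1, y)) * wt (r (i + 1, y)))))
        - (q⁻¹) ^ (b i - b (i + 1)) * (∏ y ∈ Finset.Ioc (i + 1) n,
          (W i (phi i r (i + 1, y) - r (i + 1, y)) *
            ((q⁻¹) ^ (r (i + 1, y)) * wt (r (i + 1, y)))))) *
      ∏ x ∈ Finset.Ioc (i + 1) n, ∏ y ∈ Finset.Ioc x n, wt (phi i r (x, y)) := by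
  have e1 : ∏ y ∈ Finset.Ioc (i + 1) n, W i (phi i r (i + 1, y) - r (i + 1, y)) =
      ∏ y ∈ Finset.Ioc (i + 1) n, W i (r (i, y)) := by
    refine Finset.prod_congr rfl fun y hy => ?_
    rw [Finset.mem_Ioc] at hy
    unfold phi
    dsimp only
    rw [if_neg (by omega), if_pos rfl, if_neg (by omega), Nat.add_sub_cancel]
  have e2 : ∏ x ∈ Finset.Ioc (i + 1) n, ∏ y ∈ Finset.Ioc x n, wt (phi i r (x, y)) =
      ∏ x ∈ Finset.Ioc (i + 1) n, ∏ y ∈ Finset.Ioc x n, wt (r (x, y)) := by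
    refine Finset.prod_congr rfl fun x hx => Finset.prod_congr rfl fun y hy => ?_
    rw [Finset.mem_Ioc] at hx
    unfold phi
    dsimp only
    rw [if_neg (by omega), if_neg (by omega)]
  have e3 : W i (r (i, i + 1)) = Cc i * ((q ^ i) ^ (r (i, i + 1)) - (q⁻¹) ^ (r (i, i + 1))) := by
    have := head_eq hi hbn hb hr
    unfold W
    rw [if_neg (by omega)]
  rw [head_eq hi hbn hb hr, pow_add, pow_add, ← Finset.prod_pow_eq_pow_sum,
    ← Finset.prod_pow_eq_pow_sum] at e3
  simp only [Finset.prod_mul_distrib]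
  rw [e1, e2]
  unfold ww
  rw [peelp_Ioc _ hi, peelp_Ioc (fun x => ∏ y ∈ Finset.Ioc x n, wt (r (x, y))) hi,
    head_eq hi hbn hb hr, e3]
  ring

theorem TT_rec {n : ℕ} {b : ℕ → ℕ} {i : ℕ} (hi : i < n)
    (hbn : b n = 0) (hb : b (i + 1) < b i) :
    TT n b i = Cc i * ((q ^ i) ^ (b i - b (i + 1)) - (q⁻¹) ^ (b i)) * TT n b (i + 1) := by
  classical
  unfold TT
  rw [← Finset.sum_fiberwise_of_maps_to (s := KF n b i) (t := KF n b (i + 1)) (g := phi i)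
    (fun r hr => mem_KF.2 (phi_mem (mem_KF.1 hr))), Finset.mul_sum]
  refine Finset.sum_congr rfl fun r' hr' => ?_
  rw [mem_KF] at hr'
  set J := Finset.Ioc (i + 1) n with hJ
  set R := ∏ x ∈ J, ∏ y ∈ Finset.Ioc x n, wt (r' (x, y)) with hR
  have key : ∑ r ∈ KF n b i with phi i r = r', ww n i r =
      ∑ β ∈ J.pi (fun y => Finset.range (r' (i + 1, y) + 1)), Cc i *
      ((q ^ i) ^ (b i - b (i + 1)) * (∏ y ∈ J.attach,
          (W i (r' (i + 1, y.1) - β y.1 y.2) * ((q ^ i) ^ (β y.1 y.2) * wt (β y.1 y.2))))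
        - (q⁻¹) ^ (b i - b (i + 1)) * (∏ y ∈ J.attach,
          (W i (r' (i + 1, y.1) - β y.1 y.2) *
            ((q⁻¹) ^ (β y.1 y.2) * wt (β y.1 y.2))))) * R := by
    refine Finset.sum_bij' (fun r _ => fun y _ => r (i + 1, y))
      (fun β _ => gg n i (b i - b (i + 1)) r' (fun y => if h : y ∈ J then β y h else 0))
      ?_ ?_ ?_ ?_ ?_
    · intro r hr
      rw [Finset.mem_filter] at hr
      rw [Finset.mem_pi]
      intro y hy
      rw [hJ, Finset.mem_Ioc] at hy
      rw [Finset.mem_range, ← hr.2]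
      unfold phi
      dsimp only
      rw [if_neg (by omega), if_pos rfl, if_neg (by omega)]
      omega
    · intro β hβ
      rw [Finset.mem_pi] at hβ
      have := gg_mem (B := fun y => if h : y ∈ J then β y h else 0) hi hbn hb hr' (by
        intro y hy hyn
        have hyJ : y ∈ J := Finset.mem_Ioc.2 ⟨hy, hyn⟩
        have := hβ y hyJ
        rw [Finset.mem_range] at this
        simp only [hyJ, dif_pos]
        omega)
      rw [Finset.mem_filter, mem_KF]
      exact this
    · intro r hr
      rw [Finset.mem_filter, mem_KF] at hr
      obtain ⟨hr, rfl⟩ := hr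
      apply gg_phi hi hbn hb hr
      intro y hy hyn
      have hyJ : y ∈ J := Finset.mem_Ioc.2 ⟨hy, hyn⟩
      simp only [hyJ, dif_pos]
    · intro β hβ
      funext y hy
      have hy' := hy
      rw [hJ, Finset.mem_Ioc] at hy'
      unfold gg
      dsimp only
      rw [if_neg (by omega), if_pos rfl, if_pos hy', dif_pos hy]
    · intro r hr
      rw [Finset.mem_filter, mem_KF] at hr
      obtain ⟨hr, rfl⟩ := hr
      rw [ww_eq hi hbn hb hr, ← Finset.prod_attach, ← Finset.prod_attach J
        (fun y => (W i (phi i r (i + 1, y) - r (i + 1, y)) *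
            ((q⁻¹) ^ (r (i + 1, y)) * wt (r (i + 1, y)))))]
  rw [key, ← Finset.sum_mul, ← Finset.mul_sum, Finset.sum_sub_distrib, ← Finset.mul_sum,
    ← Finset.mul_sum, ← Finset.prod_sum J (fun y => Finset.range (r' (i + 1, y) + 1))
      (fun y β => W i (r' (i + 1, y) - β) * ((q ^ i) ^ β * wt β)),
    ← Finset.prod_sum J (fun y => Finset.range (r' (i + 1, y) + 1))
      (fun y β => W i (r' (i + 1, y) - β) * ((q⁻¹) ^ β * wt β))]
  simp only [conv_u, conv_v]
  rw [Finset.prod_mul_distrib, Finset.prod_pow_eq_pow_sum,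
    row_sum (show i + 1 ≤ n by omega) hbn hr']
  have e : (q⁻¹) ^ (b i) = (q⁻¹) ^ (b i - b (i + 1)) * (q⁻¹) ^ (b (i + 1)) := by
    rw [← pow_add]; congr 1; omega
  rw [e]
  unfold ww
  rw [← hJ, ← hR]
  ring

theorem TT_end (n : ℕ) (b : ℕ → ℕ) : TT n b n = 1 := by
  have : KF n b n = {0} := by
    ext r
    rw [mem_KF, Finset.mem_singleton]
    constructor
    · intro h
      funext ⟨x, y⟩
      exact h.1 x y (by omega)
    · rintro rfl
      exact ⟨fun _ _ _ => rfl, fun k hk hk' => by omega⟩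
  unfold TT
  rw [this]
  simp [ww]

theorem TT_prod {n : ℕ} {b : ℕ → ℕ} (hbn : b n = 0)
    (hb : ∀ i, 1 ≤ i → i < n → b (i + 1) < b i) (j : ℕ) (hj : j + 1 ≤ n) :
    TT n b 1 = (∏ i ∈ Finset.Icc 1 j,
      (Cc i * ((q ^ i) ^ (b i - b (i + 1)) - (q⁻¹) ^ (b i)))) * TT n b (j + 1) := by
  induction j with
  | zero => simp
  | succ j ih =>
    rw [ih (by omega), Finset.prod_Icc_succ_top (by omega),
      TT_rec (i := j + 1) (by omega) hbn (hb _ (by omega) (by omega))]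
    ring

theorem fun_eq_iff_cum (f g : ℕ → ℤ) :
    f = g ↔ ∀ k, ∑ x ∈ Finset.range (k + 1), f x = ∑ x ∈ Finset.range (k + 1), g x := by
  constructor
  · rintro rfl _; rfl
  · intro h
    funext k
    cases k with
    | zero => simpa using h 0
    | succ k =>
      have h1 := h k
      have h2 := h (k + 1)
      rw [Finset.sum_range_succ, Finset.sum_range_succ _ (k + 1), h1] at h2
      exact add_left_cancel h2

theorem cum_root (i j k : ℕ) : ∑ x ∈ Finset.range (k + 1), rootZ i j x =
    (if i ≤ k then 1 else 0) - (if j ≤ k then 1 else 0) := by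
  unfold rootZ
  rw [Finset.sum_sub_distrib, Finset.sum_ite_eq', Finset.sum_ite_eq']
  simp only [Finset.mem_range, Nat.lt_succ_iff]

theorem cum_sum {ι : Type*} (s : Finset ι) (c : ι → ℤ) (f g : ι → ℕ) (k : ℕ) :
    ∑ x ∈ Finset.range (k + 1), (∑ p ∈ s, c p • rootZ (f p) (g p)) x =
      ∑ p ∈ s, c p * ((if f p ≤ k then 1 else 0) - (if g p ≤ k then 1 else 0)) := by
  simp only [Finset.sum_apply, Pi.smul_apply, smul_eq_mul]
  rw [Finset.sum_comm]
  refine Finset.sum_congr rfl fun p _ => ?_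
  rw [← Finset.mul_sum, cum_root]

theorem mem_pairs {n : ℕ} {x y : ℕ} : (x, y) ∈ pairs n ↔ 1 ≤ x ∧ x < y ∧ y ≤ n := by
  simp only [pairs, Finset.mem_filter, Finset.mem_product, Finset.mem_Icc]
  omega

theorem cum_lhs (n : ℕ) (r : ℕ × ℕ → ℕ) (k : ℕ) :
    ∑ p ∈ pairs n, (r p : ℤ) * ((if p.1 ≤ k then 1 else 0) - (if p.2 ≤ k then 1 else 0)) =
      ((∑ x ∈ Finset.Icc 1 k, ∑ y ∈ Finset.Ioc k n, r (x, y) : ℕ) : ℤ) := by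
  rw [← Finset.sum_product', Nat.cast_sum]
  symm
  have hsub : Finset.Icc 1 k ×ˢ Finset.Ioc k n ⊆ pairs n := by
    rintro ⟨x, y⟩ h
    simp only [Finset.mem_product, Finset.mem_Icc, Finset.mem_Ioc] at h
    rw [mem_pairs]
    omega
  rw [← Finset.sum_subset hsub (f := fun p => (r p : ℤ) *
    ((if p.1 ≤ k then 1 else 0) - (if p.2 ≤ k then 1 else 0)))]
  · refine Finset.sum_congr rfl ?_
    rintro ⟨x, y⟩ h
    simp only [Finset.mem_product, Finset.mem_Icc, Finset.mem_Ioc] at h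
    dsimp only
    rw [if_pos (by omega), if_neg (by omega)]
    simp
  · rintro ⟨x, y⟩ h h'
    simp only [Finset.mem_product, Finset.mem_Icc, Finset.mem_Ioc] at h'
    rw [mem_pairs] at h
    dsimp only
    by_cases hx : x ≤ k
    · rw [if_pos hx, if_pos (by omega)]; simp
    · rw [if_neg hx, if_neg (by omega)]; simp

theorem cum_rhs (n : ℕ) (a : ℕ → ℤ) (k : ℕ) :
    ∑ i ∈ Finset.Icc 1 (n - 1), a i * ((if i ≤ k then 1 else 0) - (if i + 1 ≤ k then 1 else 0)) =
      if k ∈ Finset.Icc 1 (n - 1) then a k else 0 := by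
  rw [← Finset.sum_ite_eq' (Finset.Icc 1 (n - 1)) k a]
  refine Finset.sum_congr rfl fun i _ => ?_
  split_ifs <;> omega

theorem kostant_iff (n : ℕ) (a : ℕ → ℤ) (b : ℕ → ℕ)
    (hab : ∀ k, 1 ≤ k → k < n → a k = b k) (r : ℕ × ℕ → ℕ) :
    IsKostant n (∑ i ∈ Finset.Icc 1 (n - 1), a i • rootZ i (i + 1)) r ↔ r ∈ KS n b 1 := by
  unfold IsKostant KS
  rw [Set.mem_ofPred_eq]
  refine and_congr ?_ ?_
  · constructor
    · intro h x y hxy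
      exact h (x, y) (by rwa [mem_pairs])
    · rintro h ⟨x, y⟩ hp
      exact h x y (by rwa [mem_pairs] at hp)
  · rw [fun_eq_iff_cum]
    simp only [cum_sum (pairs n) (fun p => (r p : ℤ)) (fun p => p.1) (fun p => p.2),
      cum_sum (Finset.Icc 1 (n - 1)) a (fun i => i) (fun i => i + 1), cum_lhs, cum_rhs]
    refine forall_congr' fun k => ?_
    by_cases h : 1 ≤ k ∧ k < n
    · rw [if_pos (by rw [Finset.mem_Icc]; omega), hab k h.1 h.2]
      constructor
      · intro h' _ _; exact_mod_cast h'
      · intro h'; exact_mod_cast h' h.1 h.2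
    · rw [if_neg (by rw [Finset.mem_Icc]; omega)]
      refine iff_of_true ?_ (fun h1 h2 => absurd ⟨h1, h2⟩ h)
      have : Finset.Icc 1 k = ∅ ∨ Finset.Ioc k n = ∅ := by
        by_cases h1 : 1 ≤ k
        · right; rw [Finset.Ioc_eq_empty_iff]; omega
        · left; rw [Finset.Icc_eq_empty_iff]; exact h1
      rcases this with h | h <;> simp [h]

theorem ww_one (n : ℕ) (hn : 1 ≤ n) (r : ℕ × ℕ → ℕ) : ww n 1 r = ∏ p ∈ pairs n, wt (r p) := by
  unfold ww
  simp only [W_one]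
  rw [← peelp_Ioc (fun x => ∏ y ∈ Finset.Ioc x n, wt (r (x, y))) (show 0 < n by omega),
    Finset.prod_sigma']
  refine Finset.prod_bij' (fun p _ => (p.1, p.2)) (fun p _ => ⟨p.1, p.2⟩) ?_ ?_ ?_ ?_ ?_
  · rintro ⟨x, y⟩ h
    simp only [Finset.mem_sigma, Finset.mem_Ioc] at h
    exact mem_pairs.2 ⟨h.1.1, h.2.1, h.2.2⟩
  · rintro ⟨x, y⟩ h
    rw [mem_pairs] at h
    simp only [Finset.mem_sigma, Finset.mem_Ioc]
    exact ⟨⟨by omega, by omega⟩, h.2.1, h.2.2⟩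
  · intros; rfl
  · intros; rfl
  · intros; rfl

theorem S_eq (n : ℕ) (hn : 1 ≤ n) (a : ℕ → ℤ) (b : ℕ → ℕ)
    (hab : ∀ k, 1 ≤ k → k < n → a k = b k) :
    S n (∑ i ∈ Finset.Icc 1 (n - 1), a i • rootZ i (i + 1)) = TT n b 1 := by
  unfold S TT
  have : {r | IsKostant n (∑ i ∈ Finset.Icc 1 (n - 1), a i • rootZ i (i + 1)) r} =
      ((KF n b 1 : Finset (ℕ × ℕ → ℕ)) : Set (ℕ × ℕ → ℕ)) := by
    ext r
    rw [Set.mem_ofPred_eq, kostant_iff n a b hab, Finset.mem_coe, mem_KF]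
  rw [this, finsum_mem_coe_finset]
  exact Finset.sum_congr rfl fun r _ => (ww_one n hn r).symm

theorem Cc_prod (N : ℕ) : ∏ i ∈ Finset.Icc 1 N, Cc i = (q - 1) ^ (N + 1) / (q ^ (N + 1) - 1) := by
  have hne : ∀ k, q ^ (k + 1) - 1 ≠ 0 := fun k => sub_ne_zero.2 (q_pow_ne_one (k + 1) (by omega))
  induction N with
  | zero =>
    have := hne 0
    simp at this ⊢
    field_simp
  | succ N ih =>
    rw [Finset.prod_Icc_succ_top (by omega), ih]
    unfold Cc
    have h1 := hne N
    have h2 := hne (N + 1)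
    field_simp
    ring

theorem factor_eq (i x y : ℕ) (h : y ≤ x) : (q ^ i) ^ (x - y) - (q⁻¹) ^ x =
    q ^ (-(x : ℤ)) * (q ^ (((i : ℤ) + 1) * x - (i : ℤ) * y) - 1) := by
  have hq := q_ne_zero
  rw [mul_sub, ← zpow_add₀ hq, mul_one, inv_pow, zpow_neg, zpow_natCast]
  congr 1
  rw [← pow_mul, ← zpow_natCast]
  congr 1
  push_cast [h]
  ring

theorem trace_product_formula_decreasing (n : ℕ) (hn : 2 ≤ n)
    (a : ℕ → ℤ)
    (hdec : ∀ i, 1 ≤ i → i + 1 ≤ n - 1 → a (i + 1) < a i)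
    (hpos : 0 < a (n - 1)) :
    S n (∑ i ∈ Finset.Icc 1 (n - 1), a i • rootZ i (i + 1)) =
      q ^ (-(∑ i ∈ Finset.Icc 1 (n - 1), a i)) * (q - 1) ^ (2 * (n - 1)) *
        qint (q ^ (n : ℤ)) (a (n - 1)) *
        ∏ i ∈ Finset.Icc 1 (n - 2), qint q (((i : ℤ) + 1) * a i - (i : ℤ) * a (i + 1)) := by
  obtain ⟨N, rfl⟩ : ∃ N, n = N + 2 := ⟨n - 2, by omega⟩
  simp only [show N + 2 - 1 = N + 1 by omega, show N + 2 - 2 = N by omega] at *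
  have hap : ∀ j, j ≤ N → 0 < a (N + 1 - j) := by
    intro j
    induction j with
    | zero => intro _; simpa using hpos
    | succ j ih =>
      intro hj
      have h1 := ih (by omega)
      have h2 := hdec (N + 1 - (j + 1)) (by omega) (by omega)
      rw [show N + 1 - (j + 1) + 1 = N + 1 - j by omega] at h2
      omega
  have hap' : ∀ k, 1 ≤ k → k < N + 2 → 0 < a k := by
    intro k h1 h2
    have := hap (N + 1 - k) (by omega)
    rwa [show N + 1 - (N + 1 - k) = k by omega] at this
  set b : ℕ → ℕ := fun k => if k < N + 2 then (a k).toNat else 0 with hbdef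
  have hab : ∀ k, 1 ≤ k → k < N + 2 → a k = b k := by
    intro k h1 h2
    have := hap' k h1 h2
    simp only [hbdef, if_pos h2]
    omega
  have hbn : b (N + 2) = 0 := by simp [hbdef]
  have hb : ∀ i, 1 ≤ i → i < N + 2 → b (i + 1) < b i := by
    intro i h1 h2
    have e1 := hab i h1 h2
    have e0 := hap' i h1 h2
    by_cases h : i + 1 < N + 2
    · have e2 := hab (i + 1) (by omega) h
      have e3 := hdec i h1 (by omega)
      omega
    · have : i + 1 = N + 2 := by omega
      rw [this, hbn]; omega
  have hS := S_eq (N + 2) (by omega) a b hab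
  rw [show N + 2 - 1 = N + 1 by omega] at hS
  rw [hS, TT_prod hbn hb (N + 1) (by omega), TT_end, mul_one, Finset.prod_mul_distrib, Cc_prod]
  have hq := q_ne_zero
  have hq1 : q - 1 ≠ 0 := by
    have := q_pow_ne_one 1 (by norm_num)
    rw [pow_one] at this
    exact sub_ne_zero.2 this
  have hqn : q ^ (N + 2) - 1 ≠ 0 := sub_ne_zero.2 (q_pow_ne_one (N + 2) (by omega))
  rw [Finset.prod_Icc_succ_top (by omega), Finset.sum_Icc_succ_top (by omega)]
  have hsum : ∀ M, q ^ (-(∑ i ∈ Finset.Icc 1 M, a i)) = ∏ i ∈ Finset.Icc 1 M, q ^ (-(a i)) := by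
    intro M
    induction M with
    | zero => simp
    | succ M ih =>
      rw [Finset.sum_Icc_succ_top (by omega), Finset.prod_Icc_succ_top (by omega), neg_add,
        zpow_add₀ hq, ih]
  have hfac : ∏ i ∈ Finset.Icc 1 N, ((q ^ i) ^ (b i - b (i + 1)) - (q⁻¹) ^ (b i)) =
      (∏ i ∈ Finset.Icc 1 N, q ^ (-(a i))) * ((q - 1) ^ N *
        ∏ i ∈ Finset.Icc 1 N, qint q (((i : ℤ) + 1) * a i - (i : ℤ) * a (i + 1))) := by
    have hc : (q - 1) ^ N = ∏ _i ∈ Finset.Icc 1 N, (q - 1) := by simp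
    rw [hc, ← Finset.prod_mul_distrib, ← Finset.prod_mul_distrib]
    refine Finset.prod_congr rfl fun i hi => ?_
    rw [Finset.mem_Icc] at hi
    rw [factor_eq i _ _ (hb i hi.1 (by omega)).le, hab i hi.1 (by omega),
      hab (i + 1) (by omega) (by omega)]
    unfold qint
    rw [mul_div_cancel₀ _ hq1]
  rw [hfac, factor_eq (N + 1) _ _ (hb (N + 1) (by omega) (by omega)).le, hbn, neg_add,
    zpow_add₀ hq, hsum, ← hab (N + 1) (by omega) (by omega)]
  unfold qint
  rw [← zpow_mul, zpow_natCast q (N + 2)]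
  have e : (((N + 1 : ℕ) : ℤ) + 1) * a (N + 1) - ((N + 1 : ℕ) : ℤ) * ((0 : ℕ) : ℤ) =
      ((N + 2 : ℕ) : ℤ) * a (N + 1) := by push_cast; ring
  rw [e, show 2 * (N + 1) = (N + 2) + N by ring, pow_add]
  ring
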